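/- Fix cog ∈ C with cog ≤ cog*, so A(cog) = {S, N, H}. Let V : ℤ × C → ℝ satisfy the value-bound property with constants t_s, t_max, ρ. Assume the sojourn-time ordering t_s < E[τ|cog,N] < E[τ|cog,H] and the condition min{ E[τ|cog,H] − E[τ|cog,N], E[τ|cog,N] − t_s } + t_s·γ^{E[τ|cog,H]}/(1 − γ^{t_max}) ≥ (t_max/(1−ρ))·max_{a ∈ A(cog)} E[γ^τ|cog,a]. Then there exist thresholds q₁*(cog) ≤ q₂*(cog) in ℤ ∪ {−∞, +∞} and a selection π(q) ∈ argmax_{a ∈ A(cog)} Q_V(q,cog,a) for each q ∈ ℤ such that π(q) = H for q ≤ q₁*(cog), π(q) = N for q₁*(cog) < q ≤ q₂*(cog), and π(q) = S for q > q₂*(cog). -/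

import Mathlib

open scoped BigOperators

namespace Fidelity

/-- The actions available to the human operator: skip, rest, normal fidelity, high fidelity. -/
inductive Action : Type
  | S | R | N | H
deriving DecidableEq

/-- Admissible action set: `{S, N, H}` for `cog ≤ cog*` and `{S, R, N, H}` for `cog > cog*`. -/
def Act {C : Type*} [LinearOrder C] (cogStar cog : C) : Finset Action :=
  if cog ≤ cogStar then {Action.S, Action.N, Action.H}
  else {Action.S, Action.R, Action.N, Action.H}

lemma Act_nonempty {C : Type*} [LinearOrder C] (cogStar cog : C) :
    (Act cogStar cog).Nonempty := by
  unfold Act; split <;> exact ⟨Action.S, by simp⟩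

/-- The reward `r(a)`: `r(H) = r_H`, `r(N) = r_N`, `r(S) = r(R) = 0`. -/
noncomputable def rew (rH rN : ℝ) : Action → ℝ
  | Action.H => rH
  | Action.N => rN
  | _ => 0

/-- Expected net immediate reward
`R((q,cog),a) = r(a) − c·E[τ|cog,a]·q − (cλ/2)·E[τ²|cog,a]`. -/
noncomputable def Rimm {C : Type*} (c lam rH rN : ℝ) (Etau Etau2 : C → Action → ℝ)
    (q : ℤ) (cog : C) (a : Action) : ℝ :=
  rew rH rN a - c * Etau cog a * (q : ℝ) - c * lam / 2 * Etau2 cog a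

/-- The Poisson probability of `w` arrivals when the mean number of arrivals is `μ`. -/
noncomputable def poissonPMF (μ : ℝ) (w : ℕ) : ℝ :=
  Real.exp (-μ) * μ ^ w / (w.factorial : ℝ)

/-- The next queue length: `q − 1 + w` under actions `S, N, H` and `q + w` under `R`. -/
def nextQ (a : Action) (q : ℤ) (w : ℕ) : ℤ :=
  if a = Action.R then q + (w : ℤ) else q - 1 + (w : ℤ)

/-- `E[γ^τ | cog, a]`, the expected discount over a sojourn in state `cog` under action `a`. -/
noncomputable def Egamma {C : Type*} [Fintype C] (γ : ℝ) (P : C → Action → ℕ → C → ℝ)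
    (cog : C) (a : Action) : ℝ :=
  ∑' (τ : ℕ), ∑' (cog' : C), γ ^ τ * P cog a τ cog'

/-- The Q-value of action `a` at `(q, cog)` for the continuation value function `V`:
`Q_V(q,cog,a) = R((q,cog),a) + Σ_{τ,cog',w} γ^τ·P(τ,cog'|cog,a)·Poisson(λτ)(w)·V(q',cog')`. -/
noncomputable def Qval {C : Type*} [Fintype C] (c lam rH rN γ : ℝ)
    (Etau Etau2 : C → Action → ℝ) (P : C → Action → ℕ → C → ℝ)
    (V : ℤ → C → ℝ) (q : ℤ) (cog : C) (a : Action) : ℝ :=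
  Rimm c lam rH rN Etau Etau2 q cog a +
    ∑' (τ : ℕ), ∑' (cog' : C), ∑' (w : ℕ),
      γ ^ τ * P cog a τ cog' * poissonPMF (lam * (τ : ℝ)) w * V (nextQ a q w) cog'

/-- `V` satisfies the value-bound property with constants `t_s`, `t_max`, `ρ`:
for all `cog'`, `q` and `Δ ∈ ℕ`,
`c·t_s·Δ/(1 − γ^{t_max}) ≤ V(q,cog') − V(q+Δ,cog') ≤ c·t_max·Δ/(1 − ρ)`. -/
def ValueBound {C : Type*} (c γ ρ : ℝ) (ts tmax : ℕ) (V : ℤ → C → ℝ) : Prop :=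
  ∀ (cog' : C) (q : ℤ) (Δ : ℕ),
    c * (ts : ℝ) * (Δ : ℝ) / (1 - γ ^ tmax) ≤ V q cog' - V (q + (Δ : ℤ)) cog' ∧
    V q cog' - V (q + (Δ : ℤ)) cog' ≤ c * (tmax : ℝ) * (Δ : ℝ) / (1 - ρ)

lemma poissonPMF_nonneg {μ : ℝ} (hμ : 0 ≤ μ) (w : ℕ) : 0 ≤ poissonPMF μ w := by
  unfold poissonPMF; positivity

lemma hasSum_poissonPMF (μ : ℝ) : HasSum (poissonPMF μ) 1 := by
  have h := (NormedSpace.expSeries_div_hasSum_exp μ).mul_left (Real.exp (-μ))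
  rw [← Real.exp_eq_exp_ℝ, ← Real.exp_add, neg_add_cancel, Real.exp_zero] at h
  exact h.congr_fun fun w => by simp [poissonPMF, mul_div_assoc]

lemma hasSum_poissonPMF_mul (μ : ℝ) : HasSum (fun w : ℕ => poissonPMF μ w * w) μ := by
  rw [← hasSum_nat_add_iff' 1]
  have h := (hasSum_poissonPMF μ).mul_left μ
  simp only [mul_one] at h
  simp only [Finset.range_one, Finset.sum_singleton, Nat.cast_zero, mul_zero, sub_zero]
  refine h.congr_fun fun w => ?_
  have h1 : ((w : ℝ) + 1) ≠ 0 := by positivity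
  have h2 : (w.factorial : ℝ) ≠ 0 := by positivity
  simp only [poissonPMF, Nat.factorial_succ, Nat.cast_mul, Nat.cast_add, Nat.cast_one, pow_succ]
  field_simp

/-- The mean of `f` over a Poisson number of arrivals exists when `f` has linear growth. -/
lemma summable_poissonPMF_mul {μ A K : ℝ} (hμ : 0 ≤ μ) {f : ℕ → ℝ}
    (hf : ∀ w : ℕ, |f w| ≤ A + K * w) : Summable fun w => poissonPMF μ w * f w := by
  refine Summable.of_norm_bounded (((hasSum_poissonPMF μ).summable.mul_left A).add
    ((hasSum_poissonPMF_mul μ).summable.mul_left K)) fun w => ?_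
  rw [Real.norm_eq_abs, abs_mul, abs_of_nonneg (poissonPMF_nonneg hμ w)]
  nlinarith [mul_le_mul_of_nonneg_left (hf w) (poissonPMF_nonneg hμ w)]

lemma abs_tsum_poissonPMF_mul_le {μ A K : ℝ} (hμ : 0 ≤ μ) {f : ℕ → ℝ}
    (hf : ∀ w : ℕ, |f w| ≤ A + K * w) : |∑' w, poissonPMF μ w * f w| ≤ A + K * μ := by
  have h := ((hasSum_poissonPMF μ).mul_left A).add ((hasSum_poissonPMF_mul μ).mul_left K)
  rw [mul_one] at h
  rw [← Real.norm_eq_abs]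
  refine tsum_of_norm_bounded h fun w => ?_
  rw [Real.norm_eq_abs, abs_mul, abs_of_nonneg (poissonPMF_nonneg hμ w)]
  nlinarith [mul_le_mul_of_nonneg_left (hf w) (poissonPMF_nonneg hμ w)]

lemma tsum_poissonPMF_mul_mem_Icc {μ L U : ℝ} (hμ : 0 ≤ μ) {f : ℕ → ℝ}
    (hs : Summable fun w => poissonPMF μ w * f w) (hf : ∀ w, f w ∈ Set.Icc L U) :
    ∑' w, poissonPMF μ w * f w ∈ Set.Icc L U := by
  have hL := (hasSum_poissonPMF μ).mul_right L
  have hU := (hasSum_poissonPMF μ).mul_right U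
  rw [one_mul] at hL hU
  exact ⟨hasSum_le (fun w => mul_le_mul_of_nonneg_left (hf w).1 (poissonPMF_nonneg hμ w))
      hL hs.hasSum,
    hasSum_le (fun w => mul_le_mul_of_nonneg_left (hf w).2 (poissonPMF_nonneg hμ w))
      hs.hasSum hU⟩

/-- Shifting the queue by one changes the expected discounted continuation value by an amount
between `L` and `U` times the expected discount. -/
lemma continuation_sub_mem_Icc {C : Type*} [Fintype C] {lam γ L U K : ℝ} (hlam : 0 ≤ lam)
    (hγ0 : 0 ≤ γ) (hγ1 : γ ≤ 1) {p : ℕ → C → ℝ} (hp : ∀ τ x, 0 ≤ p τ x)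
    (hs0 : Summable fun τ => ∑ x, p τ x) (hs1 : Summable fun τ : ℕ => (τ : ℝ) * ∑ x, p τ x)
    {f g : ℕ → C → ℝ} {A : C → ℝ} (hf : ∀ w x, |f w x| ≤ A x + K * w)
    (hg : ∀ w x, |g w x| ≤ A x + K * w) (hfg : ∀ w x, f w x - g w x ∈ Set.Icc L U) :
    (∑' (τ : ℕ), ∑' (x : C), ∑' (w : ℕ), γ ^ τ * p τ x * poissonPMF (lam * (τ : ℝ)) w * f w x) -
      (∑' (τ : ℕ), ∑' (x : C), ∑' (w : ℕ),
        γ ^ τ * p τ x * poissonPMF (lam * (τ : ℝ)) w * g w x) ∈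
      Set.Icc (L * ∑' (τ : ℕ), γ ^ τ * ∑ x, p τ x) (U * ∑' (τ : ℕ), γ ^ τ * ∑ x, p τ x) := by
  have hμ : ∀ τ : ℕ, 0 ≤ lam * (τ : ℝ) := fun τ => by positivity
  have hpt : ∀ τ, 0 ≤ ∑ x, p τ x := fun τ => Finset.sum_nonneg fun x _ => hp τ x
  have key : ∀ h : ℕ → C → ℝ, (∀ w x, |h w x| ≤ A x + K * w) →
      Summable fun τ : ℕ =>
        ∑ x, γ ^ τ * p τ x * ∑' w, poissonPMF (lam * (τ : ℝ)) w * h w x := by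
    intro h hh
    refine summable_sum fun x _ => ?_
    have hb0 : Summable fun τ => p τ x :=
      Summable.of_nonneg_of_le (fun τ => hp τ x)
        (fun τ => Finset.single_le_sum (fun y _ => hp τ y) (Finset.mem_univ x)) hs0
    have hb1 : Summable fun τ : ℕ => (τ : ℝ) * p τ x :=
      Summable.of_nonneg_of_le (fun τ => mul_nonneg (Nat.cast_nonneg τ) (hp τ x))
        (fun τ => mul_le_mul_of_nonneg_left
          (Finset.single_le_sum (fun y _ => hp τ y) (Finset.mem_univ x)) (Nat.cast_nonneg τ)) hs1
    refine Summable.of_norm_bounded ((hb0.mul_left (A x)).add (hb1.mul_left (K * lam)))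
      fun τ => ?_
    have h1 := abs_tsum_poissonPMF_mul_le (hμ τ) fun w => hh w x
    rw [Real.norm_eq_abs, abs_mul, abs_mul, abs_of_nonneg (hp τ x),
      abs_of_nonneg (pow_nonneg hγ0 τ)]
    calc γ ^ τ * p τ x * |∑' w, poissonPMF (lam * (τ : ℝ)) w * h w x|
        ≤ 1 * p τ x * (A x + K * (lam * τ)) := by
          gcongr
          · exact mul_nonneg zero_le_one (hp τ x)
          · exact hp τ x
          · exact pow_le_one₀ hγ0 hγ1
      _ = A x * p τ x + K * lam * (τ * p τ x) := by ring
  have hd : Summable fun τ : ℕ => γ ^ τ * ∑ x, p τ x :=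
    Summable.of_nonneg_of_le (fun τ => mul_nonneg (pow_nonneg hγ0 τ) (hpt τ))
      (fun τ => mul_le_of_le_one_left (hpt τ) (pow_le_one₀ hγ0 hγ1)) hs0
  have hstep : ∀ τ : ℕ,
      (∑ x, γ ^ τ * p τ x * ∑' w, poissonPMF (lam * (τ : ℝ)) w * f w x) -
        (∑ x, γ ^ τ * p τ x * ∑' w, poissonPMF (lam * (τ : ℝ)) w * g w x) ∈
      Set.Icc (L * (γ ^ τ * ∑ x, p τ x)) (U * (γ ^ τ * ∑ x, p τ x)) := by
    intro τ
    have hx : ∀ x, (∑' w, poissonPMF (lam * (τ : ℝ)) w * f w x) -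
        (∑' w, poissonPMF (lam * (τ : ℝ)) w * g w x) ∈ Set.Icc L U := by
      intro x
      have sf := summable_poissonPMF_mul (hμ τ) fun w => hf w x
      have sg := summable_poissonPMF_mul (hμ τ) fun w => hg w x
      have sfg := sf.sub sg
      rw [← sf.tsum_sub sg]
      simp only [← mul_sub] at sfg ⊢
      exact tsum_poissonPMF_mul_mem_Icc (hμ τ) sfg fun w => hfg w x
    rw [← Finset.sum_sub_distrib, Finset.mul_sum, Finset.mul_sum, Finset.mul_sum]
    have hw : ∀ x, 0 ≤ γ ^ τ * p τ x := fun x => mul_nonneg (pow_nonneg hγ0 τ) (hp τ x)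
    exact ⟨Finset.sum_le_sum fun x _ => by nlinarith [hw x, (hx x).1],
      Finset.sum_le_sum fun x _ => by nlinarith [hw x, (hx x).2]⟩
  simp only [tsum_fintype, mul_assoc (_ * _) (poissonPMF _ _), tsum_mul_left]
  rw [← (key f hf).tsum_sub (key g hg), ← tsum_mul_left, ← tsum_mul_left]
  exact ⟨(hd.mul_left L).tsum_le_tsum (fun τ => (hstep τ).1) ((key f hf).sub (key g hg)),
    ((key f hf).sub (key g hg)).tsum_le_tsum (fun τ => (hstep τ).2) (hd.mul_left U)⟩

/-- Jensen's inequality for `γ ^ ·` on a discrete distribution on `ℕ`. -/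
lemma rpow_tsum_le_tsum_pow {γ m : ℝ} (hγ0 : 0 < γ) (hγ1 : γ ≤ 1) {p : ℕ → ℝ}
    (hp : ∀ τ, 0 ≤ p τ) (hp1 : HasSum p 1) (hm : HasSum (fun τ : ℕ => (τ : ℝ) * p τ) m) :
    γ ^ m ≤ ∑' τ : ℕ, γ ^ τ * p τ := by
  have hd : Summable fun τ : ℕ => γ ^ τ * p τ :=
    Summable.of_nonneg_of_le (fun τ => mul_nonneg (pow_nonneg hγ0.le τ) (hp τ))
      (fun τ => mul_le_of_le_one_left (hp τ) (pow_le_one₀ hγ0.le hγ1)) hp1.summable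
  have h := (hp1.mul_left (γ ^ m * (1 - Real.log γ * m))).add
    (hm.mul_left (γ ^ m * Real.log γ))
  have e : γ ^ m * (1 - Real.log γ * m) * 1 + γ ^ m * Real.log γ * m = γ ^ m := by ring
  rw [e] at h
  refine hasSum_le (fun τ => ?_) h hd.hasSum
  have ht : γ ^ τ = γ ^ m * Real.exp (Real.log γ * (τ - m)) := by
    rw [← Real.rpow_natCast, Real.rpow_def_of_pos hγ0, Real.rpow_def_of_pos hγ0, ← Real.exp_add]
    ring_nf
  have h1 : γ ^ m * (Real.log γ * (τ - m) + 1) ≤ γ ^ τ := by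
    rw [ht]
    exact mul_le_mul_of_nonneg_left (Real.add_one_le_exp _) (Real.rpow_nonneg hγ0.le m)
  nlinarith [mul_le_mul_of_nonneg_right h1 (hp τ)]

lemma exists_ereal_le_iff_mem {s : Set ℤ} (hs : IsLowerSet s) :
    ∃ t : EReal, ∀ q : ℤ, ((q : ℝ) : EReal) ≤ t ↔ q ∈ s := by
  refine ⟨⨆ x ∈ s, ((x : ℝ) : EReal), fun q => ⟨fun hq => ?_, fun hq => ?_⟩⟩
  · by_contra hqs
    have hle : (⨆ x ∈ s, ((x : ℝ) : EReal)) ≤ (((q - 1 : ℤ) : ℝ) : EReal) := by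
      refine iSup₂_le fun x hx => ?_
      have hxq : x ≤ q - 1 := by
        by_contra! h
        exact hqs (hs (by omega) hx)
      exact_mod_cast hxq
    have hlt : q ≤ q - 1 := by exact_mod_cast hq.trans hle
    omega
  · exact le_iSup₂ (f := fun (x : ℤ) (_ : x ∈ s) => ((x : ℝ) : EReal)) q hq

/-- Three functions on `ℤ` with antitone consecutive differences are maximised successively. -/
lemma exists_thresholds {F G K : ℤ → ℝ} (hFG : Antitone fun q => F q - G q)
    (hGK : Antitone fun q => G q - K q) :
    ∃ (q₁ q₂ : EReal), q₁ ≤ q₂ ∧ ∀ q : ℤ,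
      (((q : ℝ) : EReal) ≤ q₁ → G q ≤ F q ∧ K q ≤ F q) ∧
      (q₁ < ((q : ℝ) : EReal) ∧ ((q : ℝ) : EReal) ≤ q₂ → F q ≤ G q ∧ K q ≤ G q) ∧
      (q₂ < ((q : ℝ) : EReal) → F q ≤ K q ∧ G q ≤ K q) := by
  have hl₁ : IsLowerSet {q | G q ≤ F q ∧ K q ≤ F q} := by
    rintro a b hba ⟨h1, h2⟩
    have := hFG hba
    have := hGK hba
    constructor <;> simp only at * <;> linarith
  have hl₂ : IsLowerSet {q | K q ≤ G q ∨ K q ≤ F q} := by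
    rintro a b hba h
    have := hFG hba
    have := hGK hba
    simp only [Set.mem_ofPred_eq] at *
    rcases h with h | h
    · left; linarith
    · right; linarith
  obtain ⟨t₁, h₁⟩ := exists_ereal_le_iff_mem hl₁
  obtain ⟨t₂, h₂⟩ := exists_ereal_le_iff_mem hl₂
  refine ⟨min t₁ t₂, t₂, min_le_right _ _, fun q => ⟨fun h => ?_, fun h => ?_, fun h => ?_⟩⟩
  · exact (h₁ q).1 (h.trans (min_le_left _ _))
  · have hq := (h₂ q).1 h.2
    have hq' : ¬ ((q : ℝ) : EReal) ≤ t₁ := fun h' => h.1.not_ge (le_min h' h.2)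
    rw [h₁ q] at hq'
    simp only [Set.mem_ofPred_eq, not_and_or, not_le] at hq hq'
    rcases hq with hq | hq <;> rcases hq' with hq' | hq' <;> constructor <;> linarith
  · have hq := mt (h₂ q).2 h.not_ge
    simp only [Set.mem_ofPred_eq, not_or, not_le] at hq
    exact ⟨hq.2.le, hq.1.le⟩

/-- threshold structure for `cog ≤ cog*`, so `A(cog) = {S,N,H}`: under the
value-bound property, the sojourn-time ordering `t_s < E[τ|cog,N] < E[τ|cog,H]`, and the
condition
`min{E[τ|cog,H]−E[τ|cog,N], E[τ|cog,N]−t_s}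
  + t_s·γ^{E[τ|cog,H]}/(1−γ^{t_max}) ≥ (t_max/(1−ρ))·max_{a ∈ A(cog)} E[γ^τ|cog,a]`,
there exist thresholds `q₁* ≤ q₂*` in `ℤ ∪ {−∞,+∞}` and a selection
`π(q) ∈ argmax_{a ∈ A(cog)} Q_V(q,cog,a)` with `π = H` up to `q₁*`, `N` on `(q₁*,q₂*]`
and `S` above `q₂*`. -/
theorem stmt15 {C : Type*} [LinearOrder C] [Fintype C]
    (cogStar : C) (c lam rH rN γ : ℝ) (ts : ℕ)
    (Etau Etau2 : C → Action → ℝ) (P : C → Action → ℕ → C → ℝ)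
    (hc : 0 < c) (hlam : 0 < lam) (hγ : γ ∈ Set.Ioo (0 : ℝ) 1)
    (hrN : 0 ≤ rN) (hrHN : rN < rH) (hts : 1 ≤ ts)
    (hPnn : ∀ cog a τ cog', 0 ≤ P cog a τ cog')
    (hP0 : ∀ cog a cog', P cog a 0 cog' = 0)
    (hPsum : ∀ cog, ∀ a ∈ Act cogStar cog, (∑' (τ : ℕ), ∑' (cog' : C), P cog a τ cog') = 1)
    (hPS : ∀ cog τ cog', τ ≠ ts → P cog Action.S τ cog' = 0)
    (hEtau : ∀ cog a, Etau cog a = ∑' (τ : ℕ), ∑' (cog' : C), (τ : ℝ) * P cog a τ cog')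
    (hEtau2 : ∀ cog a, Etau2 cog a = ∑' (τ : ℕ), ∑' (cog' : C), (τ : ℝ) ^ 2 * P cog a τ cog')
    (hMom2 : ∀ cog a, Summable fun τ : ℕ => (τ : ℝ) ^ 2 * ∑' (cog' : C), P cog a τ cog')
    (tmax : ℕ) (htmax : 1 ≤ tmax) (ρ : ℝ) (hρ : ρ ∈ Set.Ioo (0 : ℝ) 1)
    (hEle : ∀ cog, ∀ a ∈ Act cogStar cog, Etau cog a ≤ (tmax : ℝ))
    (cog : C) (hcog : cog ≤ cogStar)
    (V : ℤ → C → ℝ) (hV : ValueBound c γ ρ ts tmax V)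
    (hord : (ts : ℝ) < Etau cog Action.N ∧ Etau cog Action.N < Etau cog Action.H)
    (hcond : min (Etau cog Action.H - Etau cog Action.N)
          (Etau cog Action.N - (ts : ℝ))
          + (ts : ℝ) * γ ^ Etau cog Action.H / (1 - γ ^ tmax)
        ≥ (tmax : ℝ) / (1 - ρ) *
          (Act cogStar cog).sup' (Act_nonempty cogStar cog) (fun a => Egamma γ P cog a)) :
    ∃ (q₁ q₂ : EReal) (π : ℤ → Action),
      q₁ ≤ q₂ ∧
      (∀ q : ℤ, π q ∈ Act cogStar cog ∧
        ∀ a ∈ Act cogStar cog, Qval c lam rH rN γ Etau Etau2 P V q cog a ≤ Qval c lam rH rN γ Etau Etau2 P V q cog (π q)) ∧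
      ∀ q : ℤ,
        (((q : ℝ) : EReal) ≤ q₁ → π q = Action.H) ∧
        (q₁ < ((q : ℝ) : EReal) ∧ ((q : ℝ) : EReal) ≤ q₂ → π q = Action.N) ∧
        (q₂ < ((q : ℝ) : EReal) → π q = Action.S) := by
  obtain ⟨hγ0, hγ1⟩ := hγ
  have hA : Act cogStar cog = {Action.S, Action.N, Action.H} := by simp [Act, hcog]
  have hγt : 0 < 1 - γ ^ tmax := sub_pos.2 (pow_lt_one₀ hγ0.le hγ1 (by omega))
  have hρ1 : 0 < 1 - ρ := sub_pos.2 hρ.2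
  simp only [tsum_fintype] at hPsum hEtau hMom2
  simp only [← Finset.mul_sum] at hEtau
  have hpt : ∀ a τ, 0 ≤ ∑ x, P cog a τ x := fun a τ => Finset.sum_nonneg fun x _ => hPnn _ _ _ _
  have hs1 : ∀ a, HasSum (fun τ : ℕ => (τ : ℝ) * ∑ x, P cog a τ x) (Etau cog a) := by
    intro a
    rw [hEtau]
    refine (Summable.of_nonneg_of_le (fun τ => mul_nonneg (Nat.cast_nonneg τ) (hpt a τ))
      (fun τ => mul_le_mul_of_nonneg_right ?_ (hpt a τ)) (hMom2 cog a)).hasSum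
    exact_mod_cast Nat.le_self_pow two_ne_zero τ
  have hs0 : ∀ a ∈ Act cogStar cog, HasSum (fun τ : ℕ => ∑ x, P cog a τ x) 1 := by
    intro a ha
    have h := hPsum cog a ha
    have hs : Summable fun τ : ℕ => ∑ x, P cog a τ x := by
      by_contra hn
      rw [tsum_eq_zero_of_not_summable hn] at h
      exact zero_ne_one h
    exact h ▸ hs.hasSum
  have hES : Etau cog Action.S = ts := by
    have h := (hs0 Action.S (by simp [hA])).mul_left (ts : ℝ)
    rw [mul_one] at h
    refine (hs1 Action.S).unique (h.congr_fun fun τ => ?_)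
    rcases eq_or_ne τ ts with rfl | hτ
    · rfl
    · simp [hPS cog τ _ hτ]
  have hEg : ∀ a, Egamma γ P cog a = ∑' τ : ℕ, γ ^ τ * ∑ x, P cog a τ x := fun a => by
    simp only [Egamma, tsum_fintype, Finset.mul_sum]
  have hJ : ∀ a ∈ Act cogStar cog, γ ^ Etau cog a ≤ Egamma γ P cog a := fun a ha =>
    (rpow_tsum_le_tsum_pow hγ0 hγ1.le (hpt a) (hs0 a ha) (hs1 a)).trans_eq (hEg a).symm
  set L : ℝ := c * ts / (1 - γ ^ tmax) with hL
  set U : ℝ := c * tmax / (1 - ρ) with hU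
  have hL0 : 0 ≤ L := by positivity
  have hV1 : ∀ q x, V q x - V (q + 1) x ∈ Set.Icc L U := fun q x => by
    simpa [hL, hU] using hV x q 1
  have hgrow : ∀ q (w : ℕ) x, |V (q + w) x| ≤ |V q x| + U * w := by
    intro q w x
    obtain ⟨h1, h2⟩ := hV x q w
    have h3 : 0 ≤ c * (ts : ℝ) * (w : ℝ) / (1 - γ ^ tmax) := by positivity
    have h4 : c * (tmax : ℝ) * (w : ℝ) / (1 - ρ) = U * w := by rw [hU]; ring
    rw [h4] at h2
    have h5 : 0 ≤ U * w := by positivity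
    rw [abs_le]
    constructor <;> linarith [neg_abs_le (V q x), le_abs_self (V q x)]
  have hdiff : ∀ a ∈ Act cogStar cog, ∀ q,
      Qval c lam rH rN γ Etau Etau2 P V q cog a -
        Qval c lam rH rN γ Etau Etau2 P V (q + 1) cog a ∈
      Set.Icc (c * Etau cog a + L * Egamma γ P cog a) (c * Etau cog a + U * Egamma γ P cog a) := by
    intro a ha q
    have haR : a ≠ Action.R := by rintro rfl; simp [hA] at ha
    have hq : ∀ (w : ℕ), q + 1 - 1 + (w : ℤ) = q - 1 + w + 1 := fun w => by ring
    have h := continuation_sub_mem_Icc (L := L) (U := U) (K := U) hlam.le hγ0.le hγ1.le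
      (p := P cog a) (hPnn cog a) (hs0 a ha).summable (hs1 a).summable
      (f := fun w x => V (q - 1 + w) x) (g := fun w x => V (q + 1 - 1 + w) x)
      (A := fun x => |V (q - 1) x| + |V (q + 1 - 1) x|)
      (fun w x => (hgrow (q - 1) w x).trans (by linarith [abs_nonneg (V (q + 1 - 1) x)]))
      (fun w x => (hgrow (q + 1 - 1) w x).trans (by linarith [abs_nonneg (V (q - 1) x)]))
      (fun w x => by simpa only [hq] using hV1 (q - 1 + w) x)
    rw [← hEg] at h
    simp only [Qval, Rimm, nextQ, if_neg haR, Int.cast_add, Int.cast_one]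
    exact ⟨by linarith [h.1], by linarith [h.2]⟩
  have hmono : ∀ a ∈ Act cogStar cog, ∀ b ∈ Act cogStar cog, Etau cog a ≤ Etau cog Action.H →
      min (Etau cog Action.H - Etau cog Action.N) (Etau cog Action.N - (ts : ℝ)) ≤
        Etau cog a - Etau cog b →
      Antitone fun q => Qval c lam rH rN γ Etau Etau2 P V q cog a -
        Qval c lam rH rN γ Etau Etau2 P V q cog b := by
    intro a ha b hb haH hab
    refine antitone_int_of_succ_le fun q => ?_
    have h1 := (hdiff a ha q).1
    have h2 := (hdiff b hb q).2
    have h3 : γ ^ Etau cog Action.H ≤ Egamma γ P cog a :=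
      (Real.rpow_le_rpow_of_exponent_ge hγ0 hγ1.le haH).trans (hJ a ha)
    have h4 := Finset.le_sup' (fun a => Egamma γ P cog a) hb
    have h5 : (tmax : ℝ) / (1 - ρ) * Egamma γ P cog b ≤ _ :=
      (mul_le_mul_of_nonneg_left h4 (by positivity)).trans hcond
    have h6 := mul_le_mul_of_nonneg_left h3 hL0
    have h7 := mul_le_mul_of_nonneg_left (h5.trans (add_le_add_left hab _)) hc.le
    have e1 : c * ((tmax : ℝ) / (1 - ρ) * Egamma γ P cog b) = U * Egamma γ P cog b := by
      rw [hU]; ring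
    have e2 : c * (Etau cog a - Etau cog b + ts * γ ^ Etau cog Action.H / (1 - γ ^ tmax)) =
        c * Etau cog a - c * Etau cog b + L * γ ^ Etau cog Action.H := by
      rw [hL]; ring
    rw [e1, e2] at h7
    linarith
  have hS : Action.S ∈ Act cogStar cog := by simp [hA]
  have hN : Action.N ∈ Act cogStar cog := by simp [hA]
  have hH : Action.H ∈ Act cogStar cog := by simp [hA]
  obtain ⟨q₁, q₂, hq, h⟩ := exists_thresholds
    (hmono Action.H hH Action.N hN le_rfl (min_le_left _ _))
    (hmono Action.N hN Action.S hS hord.2.le (by rw [hES]; exact min_le_right _ _))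
  refine ⟨q₁, q₂, fun q => if ((q : ℝ) : EReal) ≤ q₁ then Action.H
    else if ((q : ℝ) : EReal) ≤ q₂ then Action.N else Action.S, hq, fun q => ?_, fun q => ?_⟩
  · obtain ⟨h1, h2, h3⟩ := h q
    rw [hA]
    beta_reduce
    split_ifs with hc1 hc2
    · simpa using ⟨(h1 hc1).2, (h1 hc1).1⟩
    · have := h2 ⟨not_le.1 hc1, hc2⟩
      simpa using ⟨this.2, this.1⟩
    · have := h3 (not_le.1 hc2)
      simpa using ⟨this.2, this.1⟩
  · refine ⟨fun h1 => if_pos h1, fun h1 => ?_, fun h1 => ?_⟩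
    · simp [h1.1.not_ge, h1.2]
    · simp [h1.not_ge, (hq.trans_lt h1).not_ge]

end Fidelity
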